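/- Assume moreover that k is algebraically closed. Let m ≥ 1 be an integer, let G ∈ M_n(k((S))), and let ∇ be the bounded k-linear operator on k((S))ⁿ (max norm) defined by ∇(v) = (d v₁, …, d vₙ)ᵀ + G·v. Equip k((Z)) with the absolute value |Σ_{i ≥ N} a_i Z^i| = r^{N/m} (a_N ≠ 0), and let ∇* be the bounded k-linear operator on k((Z))ⁿ defined by ∇*(v) = ((1/m)·Z·dv₁/dZ, …, (1/m)·Z·dvₙ/dZ)ᵀ + G(Z^m)·v, where G(Z^m) is obtained from G by the substitution S = Z^m. Then the classical spectrum of ∇* in L_k(k((Z))ⁿ) equals ⋃_{i=0}^{m−1} ((i/m)·1_k + classical spectrum of ∇ in L_k(k((S))ⁿ)). -/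

import Mathlib

noncomputable section
open scoped Classical

/-- The operator `d = S·d/dS` on `k((S))`. -/
def dOp {k : Type*} [Field k] (f : LaurentSeries k) : LaurentSeries k :=
  ⟨fun i => (i : k) * f.coeff i,
    f.isPWO_support'.mono fun i hi => by
      simp only [Function.mem_support, ne_eq] at hi ⊢
      intro h
      exact hi (by rw [h, mul_zero])⟩

/-- The operator `d_Z = (1/m)·Z·d/dZ` on `k((Z))`. -/
def dZ {k : Type*} [Field k] (m : ℕ) (f : LaurentSeries k) : LaurentSeries k :=
  ⟨fun i => ((i : k) / (m : k)) * f.coeff i,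
    f.isPWO_support'.mono fun i hi => by
      simp only [Function.mem_support, ne_eq] at hi ⊢
      intro h
      exact hi (by rw [h, mul_zero])⟩

/-- The substitution `S = Z^m` from `k((S))` to `k((Z))`: `Σ aᵢ Sⁱ ↦ Σ aᵢ Z^{m·i}`. -/
def substPow {k : Type*} [Field k] (m : ℕ) (f : LaurentSeries k) : LaurentSeries k :=
  ⟨fun i => if (m : ℤ) ∣ i then f.coeff (i / (m : ℤ)) else 0, by
    refine (f.isPWO_support'.image_of_monotone
      (f := fun j : ℤ => (m : ℤ) * j)
      (fun a b hab => mul_le_mul_of_nonneg_left hab (by positivity))).mono ?_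
    intro i hi
    simp only [Function.mem_support, ne_eq] at hi
    by_cases h : (m : ℤ) ∣ i
    · refine ⟨i / (m : ℤ), ?_, Int.mul_ediv_cancel' h⟩
      simp only [Function.mem_support, ne_eq]
      intro hc
      exact hi (by rw [if_pos h, hc])
    · exact absurd (if_neg h) hi⟩

/-- The `S`-adic absolute value on `k((S))` with `|S| = r` (and `k` trivially valued). -/
def lnorm {k : Type*} [Field k] (r : ℝ) (f : LaurentSeries k) : ℝ :=
  if f = 0 then 0 else r ^ f.order

/-- The absolute value on `k((Z))` given by `|Σ_{i ≥ N} aᵢ Zⁱ| = r^{N/m}` (`a_N ≠ 0`),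
so that `|Z| = r^{1/m}`. -/
def lnormZ {k : Type*} [Field k] (r : ℝ) (m : ℕ) (f : LaurentSeries k) : ℝ :=
  if f = 0 then 0 else r ^ ((f.order : ℝ) / (m : ℝ))

/-- The max norm on `n`-tuples of Laurent series, relative to a norm `N`. -/
def vnorm {k : Type*} [Field k] (N : LaurentSeries k → ℝ) {n : ℕ}
    (v : Fin n → LaurentSeries k) : ℝ :=
  sSup (Set.range fun i => N (v i))

/-- Invertibility of an operator on `n`-tuples of Laurent series in the corresponding
algebra of bounded `k`-linear operators (for the max norm relative to `N`). -/
def InvertibleOpV {k : Type*} [Field k] (N : LaurentSeries k → ℝ) {n : ℕ}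
    (φ : (Fin n → LaurentSeries k) → (Fin n → LaurentSeries k)) : Prop :=
  ∃ ψ : (Fin n → LaurentSeries k) → (Fin n → LaurentSeries k), IsLinearMap k ψ ∧
    (∃ C : ℝ, ∀ v, vnorm N (ψ v) ≤ C * vnorm N v) ∧
    (∀ v, ψ (φ v) = v) ∧ (∀ v, φ (ψ v) = v)

section Ramification

variable {k : Type*} [Field k]

/-! Multiplicativity of the substitution `S = Z^m`. -/

lemma substPow_eq_embDomain {m : ℕ} (hm : 0 < m) (f : LaurentSeries k) :
    substPow m f = HahnSeries.embDomain
      (OrderEmbedding.ofStrictMono (fun j : ℤ => (m : ℤ) * j)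
        fun _ _ h => mul_lt_mul_of_pos_left h (by exact_mod_cast hm)) f := by
  have hm' : (m : ℤ) ≠ 0 := by exact_mod_cast hm.ne'
  ext l
  by_cases h : (m : ℤ) ∣ l
  · obtain ⟨q, rfl⟩ := h
    have key := HahnSeries.embDomain_coeff (f := OrderEmbedding.ofStrictMono
      (fun j : ℤ => (m : ℤ) * j) fun _ _ h => mul_lt_mul_of_pos_left h (by exact_mod_cast hm))
      (x := f) (a := q)
    refine Eq.trans ?_ key.symm
    simp [substPow, Int.mul_ediv_cancel_left _ hm']
  · rw [HahnSeries.embDomain_of_notMem_range]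
    · simp [substPow, h]
    · rintro ⟨q, rfl⟩
      exact h ⟨q, rfl⟩

lemma substPow_mul {m : ℕ} (hm : 0 < m) (f g : LaurentSeries k) :
    substPow m (f * g) = substPow m f * substPow m g := by
  simp only [substPow_eq_embDomain hm]
  exact HahnSeries.embDomain_mul _ (fun x y => mul_add (m : ℤ) x y) f g

/-- The `k`-linear map `f ↦ Z^i · f(Z^m)` from `k((S))` to `k((Z))`. -/
def ramEmb (k : Type*) [Field k] (m i : ℕ) : LaurentSeries k →ₗ[k] LaurentSeries k where
  toFun f := HahnSeries.single (i : ℤ) 1 * substPow m f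
  map_add' f g := by
    rw [← mul_add]
    congr 1
    ext l
    by_cases h : (m : ℤ) ∣ l <;> simp [substPow, h]
  map_smul' c f := by
    ext l
    by_cases h : (m : ℤ) ∣ l - i <;> simp [substPow, HahnSeries.coeff_single_mul, h]

lemma ramEmb_coeff (m i : ℕ) (f : LaurentSeries k) (l : ℤ) :
    (ramEmb k m i f).coeff l = if (m : ℤ) ∣ l - i then f.coeff ((l - i) / m) else 0 := by
  simp [ramEmb, substPow, HahnSeries.coeff_single_mul]

lemma substPow_mul_ramEmb {m : ℕ} (hm : 0 < m) (i : ℕ) (g f : LaurentSeries k) :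
    substPow m g * ramEmb k m i f = ramEmb k m i (g * f) := by
  simp only [ramEmb, LinearMap.coe_mk, AddHom.coe_mk, substPow_mul hm]
  ring

/-- The `k`-linear map from `k((Z))` to `k((S))` extracting the coefficients with exponents
congruent to `i` modulo `m`. -/
def ramPart (k : Type*) [Field k] (m : ℕ) [NeZero m] (i : ℕ) :
    LaurentSeries k →ₗ[k] LaurentSeries k where
  toFun f := HahnSeries.ofSuppBddBelow (fun j : ℤ => f.coeff (m * j + i)) (by
    refine ⟨-|f.order| - i, fun j hj => ?_⟩
    have h1 : f.order ≤ m * j + i := HahnSeries.order_le_of_coeff_ne_zero hj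
    have h2 : (1 : ℤ) ≤ m := by exact_mod_cast NeZero.one_le
    have h3 := neg_abs_le f.order
    have h4 : (0 : ℤ) ≤ i := by positivity
    have h5 := abs_nonneg f.order
    by_contra! h
    nlinarith)
  map_add' f g := rfl
  map_smul' c f := rfl

lemma ramPart_coeff (m : ℕ) [NeZero m] (i : ℕ) (f : LaurentSeries k) (j : ℤ) :
    (ramPart k m i f).coeff j = f.coeff (m * j + i) := rfl

lemma ramPart_ramEmb (m : ℕ) [NeZero m] (i j : Fin m) (f : LaurentSeries k) :
    ramPart k m j (ramEmb k m i f) = if j = i then f else 0 := by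
  ext q
  have hm : (m : ℤ) ≠ 0 := by exact_mod_cast NeZero.ne m
  rw [ramPart_coeff, ramEmb_coeff]
  split_ifs with h1 h2 h2
  · subst h2
    simp [Int.mul_ediv_cancel_left _ hm]
  · exfalso
    rw [add_sub_assoc, Int.dvd_add_right (dvd_mul_right _ _)] at h1
    have := Int.eq_zero_of_abs_lt_dvd h1 (by rw [abs_lt]; omega)
    omega
  · subst h2
    simp at h1
  · rfl

lemma ramPart_injective (m : ℕ) [NeZero m] {f g : LaurentSeries k}
    (h : ∀ i : Fin m, ramPart k m i f = ramPart k m i g) : f = g := by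
  have hm : 0 < (m : ℤ) := by exact_mod_cast NeZero.pos m
  ext l
  have h0 := Int.emod_nonneg l hm.ne'
  have h1 := Int.emod_lt_of_pos l hm
  have key := congrArg (fun f => f.coeff (l / m)) (h ⟨(l % m).toNat, by omega⟩)
  simp only [ramPart_coeff] at key
  rwa [Int.toNat_of_nonneg h0, Int.mul_ediv_add_emod] at key

lemma sum_ramEmb_ramPart (m : ℕ) [NeZero m] (f : LaurentSeries k) :
    ∑ i : Fin m, ramEmb k m i (ramPart k m i f) = f :=
  ramPart_injective m fun j => by simp [map_sum, ramPart_ramEmb]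

lemma ramPart_substPow_mul (m : ℕ) [NeZero m] (i : Fin m) (g f : LaurentSeries k) :
    ramPart k m i (substPow m g * f) = g * ramPart k m i f := by
  conv_lhs => rw [← sum_ramEmb_ramPart m f, Finset.mul_sum]
  simp [substPow_mul_ramEmb (NeZero.pos m), map_sum, ramPart_ramEmb]

lemma ramPart_dZ [CharZero k] (m : ℕ) [NeZero m] (i : ℕ) (f : LaurentSeries k) :
    ramPart k m i (dZ m f)
      = dOp (ramPart k m i f) + ((i : k) / (m : k)) • ramPart k m i f := by
  have hm : (m : k) ≠ 0 := by exact_mod_cast NeZero.ne m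
  ext j
  rw [HahnSeries.coeff_add, HahnSeries.coeff_smul]
  simp only [ramPart_coeff, dZ, dOp, smul_eq_mul]
  push_cast
  field_simp

/-! Norm estimates. -/

lemma lnorm_nonneg {r : ℝ} (hr : 0 < r) (f : LaurentSeries k) : 0 ≤ lnorm r f := by
  unfold lnorm
  split_ifs <;> positivity

lemma lnormZ_nonneg {r : ℝ} (hr : 0 < r) (m : ℕ) (f : LaurentSeries k) : 0 ≤ lnormZ r m f := by
  unfold lnormZ
  split_ifs <;> positivity

lemma lnorm_le {r B : ℝ} (hB : 0 ≤ B) {f : LaurentSeries k}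
    (h : ∀ j, f.coeff j ≠ 0 → r ^ (j : ℝ) ≤ B) : lnorm r f ≤ B := by
  unfold lnorm
  split_ifs with hf
  · exact hB
  · rw [← Real.rpow_intCast]
    exact h _ (HahnSeries.coeff_order_eq_zero.not.mpr hf)

lemma lnormZ_le {r B : ℝ} (hB : 0 ≤ B) {m : ℕ} {f : LaurentSeries k}
    (h : ∀ j, f.coeff j ≠ 0 → r ^ ((j : ℝ) / m) ≤ B) : lnormZ r m f ≤ B := by
  unfold lnormZ
  split_ifs with hf
  · exact hB
  · exact h _ (HahnSeries.coeff_order_eq_zero.not.mpr hf)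

lemma le_lnorm {r : ℝ} (hr0 : 0 < r) (hr1 : r < 1) {f : LaurentSeries k} {j : ℤ}
    (h : f.coeff j ≠ 0) : r ^ (j : ℝ) ≤ lnorm r f := by
  have hf : f ≠ 0 := by rintro rfl; simp at h
  rw [lnorm, if_neg hf, ← Real.rpow_intCast]
  exact Real.rpow_le_rpow_of_exponent_ge hr0 hr1.le
    (by exact_mod_cast HahnSeries.order_le_of_coeff_ne_zero h)

lemma le_lnormZ {r : ℝ} (hr0 : 0 < r) (hr1 : r < 1) (m : ℕ) {f : LaurentSeries k} {j : ℤ}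
    (h : f.coeff j ≠ 0) : r ^ ((j : ℝ) / m) ≤ lnormZ r m f := by
  have hf : f ≠ 0 := by rintro rfl; simp at h
  rw [lnormZ, if_neg hf]
  refine Real.rpow_le_rpow_of_exponent_ge hr0 hr1.le (div_le_div_of_nonneg_right ?_ (by positivity))
  exact_mod_cast HahnSeries.order_le_of_coeff_ne_zero h

lemma lnormZ_add_le {r : ℝ} (hr0 : 0 < r) (hr1 : r < 1) (m : ℕ) (f g : LaurentSeries k) :
    lnormZ r m (f + g) ≤ lnormZ r m f + lnormZ r m g := by
  have hf := lnormZ_nonneg hr0 m f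
  have hg := lnormZ_nonneg hr0 m g
  refine lnormZ_le (by positivity) fun j hj => ?_
  by_cases h : f.coeff j = 0
  · have h' : g.coeff j ≠ 0 := by simpa [h] using hj
    linarith [le_lnormZ hr0 hr1 m h']
  · linarith [le_lnormZ hr0 hr1 m h]

lemma lnormZ_ramEmb_le {r : ℝ} (hr0 : 0 < r) (hr1 : r < 1) (m : ℕ) [NeZero m] (i : ℕ)
    (f : LaurentSeries k) :
    lnormZ r m (ramEmb k m i f) ≤ r ^ ((i : ℝ) / m) * lnorm r f := by
  have hm : (m : ℝ) ≠ 0 := by exact_mod_cast NeZero.ne m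
  have hm' : (m : ℤ) ≠ 0 := by exact_mod_cast NeZero.ne m
  have hf := lnorm_nonneg hr0 f
  refine lnormZ_le (by positivity) fun l hl => ?_
  rw [ramEmb_coeff] at hl
  split_ifs at hl with h
  · obtain ⟨q, hq⟩ := h
    rw [hq, Int.mul_ediv_cancel_left _ hm'] at hl
    obtain rfl : l = i + m * q := by omega
    have : (((i + m * q : ℤ) : ℝ) / m) = (i : ℝ) / m + q := by push_cast; field_simp
    rw [this, Real.rpow_add hr0]
    exact mul_le_mul_of_nonneg_left (le_lnorm hr0 hr1 hl) (by positivity)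
  · exact absurd rfl hl

lemma lnorm_ramPart_le {r : ℝ} (hr0 : 0 < r) (hr1 : r < 1) (m : ℕ) [NeZero m] (i : ℕ)
    (f : LaurentSeries k) :
    lnorm r (ramPart k m i f) ≤ r ^ (-((i : ℝ) / m)) * lnormZ r m f := by
  have hm : (m : ℝ) ≠ 0 := by exact_mod_cast NeZero.ne m
  have hf := lnormZ_nonneg hr0 m f
  refine lnorm_le (by positivity) fun q hq => ?_
  rw [ramPart_coeff] at hq
  have : (q : ℝ) = -((i : ℝ) / m) + ((m * q + i : ℤ) : ℝ) / m := by push_cast; field_simp; ring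
  rw [this, Real.rpow_add hr0]
  exact mul_le_mul_of_nonneg_left (le_lnormZ hr0 hr1 m hq) (by positivity)

variable {n : ℕ}

lemma vnorm_nonneg {N : LaurentSeries k → ℝ} (hN : ∀ f, 0 ≤ N f) (v : Fin n → LaurentSeries k) :
    0 ≤ vnorm N v :=
  Real.sSup_nonneg (by rintro _ ⟨i, rfl⟩; exact hN _)

lemma vnorm_le {N : LaurentSeries k → ℝ} {v : Fin n → LaurentSeries k} {B : ℝ} (hB : 0 ≤ B)
    (h : ∀ i, N (v i) ≤ B) : vnorm N v ≤ B :=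
  Real.sSup_le (by rintro _ ⟨i, rfl⟩; exact h i) hB

lemma le_vnorm (N : LaurentSeries k → ℝ) (v : Fin n → LaurentSeries k) (i : Fin n) :
    N (v i) ≤ vnorm N v :=
  le_csSup (Set.finite_range _).bddAbove ⟨i, rfl⟩

lemma vnorm_sum_le {r : ℝ} (hr0 : 0 < r) (hr1 : r < 1) (m : ℕ) {ι : Type*} (s : Finset ι)
    (v : ι → Fin n → LaurentSeries k) :
    vnorm (lnormZ r m) (∑ i ∈ s, v i) ≤ ∑ i ∈ s, vnorm (lnormZ r m) (v i) := by
  refine Finset.le_sum_of_subadditive _ ?_ ?_ s v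
  · exact vnorm_le le_rfl fun i => by simp [lnormZ]
  · intro v w
    have hv := vnorm_nonneg (lnormZ_nonneg hr0 m) v
    have hw := vnorm_nonneg (lnormZ_nonneg hr0 m) w
    exact vnorm_le (by positivity) fun i => (lnormZ_add_le hr0 hr1 m _ _).trans
      (add_le_add (le_vnorm _ v i) (le_vnorm _ w i))

lemma vnorm_compLeft_le {N N' : LaurentSeries k → ℝ} (hN' : ∀ f, 0 ≤ N' f) {c : ℝ} (hc : 0 ≤ c)
    {T : LaurentSeries k →ₗ[k] LaurentSeries k} (hT : ∀ f, N (T f) ≤ c * N' f)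
    (v : Fin n → LaurentSeries k) : vnorm N (T.compLeft (Fin n) v) ≤ c * vnorm N' v :=
  vnorm_le (mul_nonneg hc (vnorm_nonneg hN' v)) fun i =>
    (hT _).trans (mul_le_mul_of_nonneg_left (le_vnorm _ v i) hc)

/-- If `φ` on `k((Z))ⁿ` restricts to `φᵢ` on the part with exponents congruent to `i` modulo `m`,
then `φ` is invertible if and only if every `φᵢ` is. -/
lemma invertibleOpV_iff_forall_ramPart {r : ℝ} (hr0 : 0 < r) (hr1 : r < 1) (m : ℕ) [NeZero m]
    {φ : (Fin n → LaurentSeries k) → (Fin n → LaurentSeries k)}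
    {φ' : Fin m → (Fin n → LaurentSeries k) → (Fin n → LaurentSeries k)}
    (h0 : ∀ i, φ' i 0 = 0)
    (h : ∀ (i : Fin m) v, (ramPart k m i).compLeft (Fin n) (φ v)
      = φ' i ((ramPart k m i).compLeft (Fin n) v)) :
    InvertibleOpV (lnormZ r m) φ ↔ ∀ i, InvertibleOpV (lnorm r) (φ' i) := by
  set P : Fin m → _ := fun i => (ramPart k m i).compLeft (Fin n)
  set E : Fin m → _ := fun i => (ramEmb k m i).compLeft (Fin n)
  replace h : ∀ i v, P i (φ v) = φ' i (P i v) := h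
  have hPE (i j v) : P j (E i v) = if j = i then v else 0 := by
    funext a
    refine (ramPart_ramEmb m i j (v a)).trans ?_
    split_ifs <;> rfl
  have hinj {v w} (hvw : ∀ i, P i v = P i w) : v = w :=
    funext fun a => ramPart_injective m fun i => congrFun (hvw i) a
  have hφE (i v) : φ (E i v) = E i (φ' i v) := hinj fun j => by
    rw [h, hPE, hPE]
    split_ifs with hji
    · rw [hji]
    · exact h0 j
  have hEn (i v) : vnorm (lnormZ r m) (E i v) ≤ r ^ ((i : ℝ) / m) * vnorm (lnorm r) v :=
    vnorm_compLeft_le (lnorm_nonneg hr0) (by positivity) (lnormZ_ramEmb_le hr0 hr1 m i) v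
  have hPn (i v) : vnorm (lnorm r) (P i v) ≤ r ^ (-((i : ℝ) / m)) * vnorm (lnormZ r m) v :=
    vnorm_compLeft_le (lnormZ_nonneg hr0 m) (by positivity) (lnorm_ramPart_le hr0 hr1 m i) v
  constructor
  · rintro ⟨ψ, hlin, ⟨C, hC⟩, hl, hr⟩ i
    refine ⟨fun v => P i (ψ (E i v)), ?_, ⟨|C|, fun v => ?_⟩, fun v => ?_, fun v => ?_⟩
    · exact ((P i) ∘ₗ hlin.mk' ψ ∘ₗ (E i)).isLinear
    · have hEv := vnorm_nonneg (lnormZ_nonneg hr0 m) (E i v)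
      calc vnorm (lnorm r) (P i (ψ (E i v)))
          ≤ r ^ (-((i : ℝ) / m)) * vnorm (lnormZ r m) (ψ (E i v)) := hPn i _
        _ ≤ r ^ (-((i : ℝ) / m)) * (|C| * (r ^ ((i : ℝ) / m) * vnorm (lnorm r) v)) := by
          gcongr
          exact (hC _).trans (mul_le_mul (le_abs_self C) (hEn i v) hEv (abs_nonneg C))
        _ = |C| * vnorm (lnorm r) v := by
          rw [Real.rpow_neg hr0.le]
          field_simp
    · beta_reduce
      rw [← hφE, hl, hPE, if_pos rfl]
    · rw [← h, hr, hPE, if_pos rfl]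
  · intro H
    choose ψ hlin hC hl hr using H
    choose C hC using hC
    have hPψ (j v) : P j (∑ i, E i (ψ i (P i v))) = ψ j (P j v) := by
      simp [map_sum, hPE]
    refine ⟨fun v => ∑ i, E i (ψ i (P i v)), ?_, ⟨∑ i, |C i|, fun v => ?_⟩, fun v => ?_,
      fun v => ?_⟩
    · convert (∑ i, E i ∘ₗ (hlin i).mk' (ψ i) ∘ₗ P i).isLinear using 2 with v
      simp
    · refine (vnorm_sum_le hr0 hr1 m _ _).trans ?_
      rw [Finset.sum_mul]
      refine Finset.sum_le_sum fun i _ => ?_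
      have hPv := vnorm_nonneg (lnorm_nonneg hr0) (P i v)
      calc vnorm (lnormZ r m) (E i (ψ i (P i v)))
          ≤ r ^ ((i : ℝ) / m) * vnorm (lnorm r) (ψ i (P i v)) := hEn i _
        _ ≤ r ^ ((i : ℝ) / m) * (|C i| * (r ^ (-((i : ℝ) / m)) * vnorm (lnormZ r m) v)) := by
          gcongr
          exact (hC i _).trans (mul_le_mul (le_abs_self _) (hPn i v) hPv (abs_nonneg _))
        _ = |C i| * vnorm (lnormZ r m) v := by
          rw [Real.rpow_neg hr0.le]
          field_simp
    · exact hinj fun j => by rw [hPψ, h, hl]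
    · exact hinj fun j => by rw [h, hPψ, hr]

end Ramification

/-- `k` algebraically closed, `G ∈ M_n(k((S)))`,
`∇ v = (d v₁, …, d vₙ)ᵀ + G·v` on `k((S))ⁿ`, and `∇* v = (d_Z v₁, …, d_Z vₙ)ᵀ + G(Z^m)·v`
on `k((Z))ⁿ` (with `|Z| = r^{1/m}`).  Then the classical spectrum of `∇*` equals
`⋃_{i=0}^{m−1} ((i/m)·1_k + classical spectrum of ∇)`. -/
theorem classical_spectrum_after_ramification
    {k : Type*} [Field k] [CharZero k] [IsAlgClosed k]
    (r : ℝ) (hr0 : 0 < r) (hr1 : r < 1)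
    (m : ℕ) (hm : 1 ≤ m) (n : ℕ) (G : Matrix (Fin n) (Fin n) (LaurentSeries k)) :
    {a : k | ¬ InvertibleOpV (lnormZ r m) (fun v : Fin n → LaurentSeries k =>
        fun i => dZ m (v i) + (∑ j, substPow m (G i j) * v j) - a • v i)}
      = ⋃ i : Fin m, (fun c => ((i : ℕ) : k) / (m : k) + c) ''
          {a : k | ¬ InvertibleOpV (lnorm r) (fun v : Fin n → LaurentSeries k =>
            fun i => dOp (v i) + (∑ j, G i j * v j) - a • v i)} := by
  have : NeZero m := ⟨by omega⟩
  have key (a : k) := invertibleOpV_iff_forall_ramPart hr0 hr1 m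
    (φ := fun v : Fin n → LaurentSeries k =>
      fun i => dZ m (v i) + (∑ j, substPow m (G i j) * v j) - a • v i)
    (φ' := fun l v i => dOp (v i) + (∑ j, G i j * v j) - (a - ((l : ℕ) : k) / (m : k)) • v i)
    (fun l => by
      have hd : dOp (0 : LaurentSeries k) = 0 := by ext j; simp [dOp]
      funext i
      simp [hd])
    (fun l v => by
      funext i
      simp only [LinearMap.compLeft_apply, Function.comp_apply, map_sub, map_add, map_sum,
        map_smul, ramPart_dZ, ramPart_substPow_mul, sub_smul]
      abel)
  ext a
  simp only [Set.mem_ofPred_eq, Set.mem_iUnion, Set.mem_image]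
  rw [key a, not_forall]
  refine exists_congr fun l => ⟨fun h => ⟨_, h, by ring⟩, ?_⟩
  rintro ⟨c, hc, rfl⟩
  rwa [add_sub_cancel_left]
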